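/- arXiv:2601.13718 — 2 statements merged into one kernel-verified Lean document; each statement's English description precedes it below -/
import Mathlib

section
/- Let θ : ℝ² → ℝ be twice continuously differentiable and suppose |∂θ/∂z₁| + |∂θ/∂z₂| ≤ D₁ and |∂²θ/∂z₁²| + |∂²θ/∂z₁∂z₂| + |∂²θ/∂z₂²| ≤ D₂ everywhere. Define θ̃(u,v) = θ( √(−2 ln u) sin(2πv), √(−2 ln u) cos(2πv) ) for u ∈ (0,1). Then for all u ∈ (0,1) and v ∈ ℝ, | ∂²θ̃/∂u² | ≤ (1/(u²√(−2 ln u)))·( 1/(−2 ln u) + 1 )·D₁ + (1/(u²·(−2 ln u)))·D₂. -/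
open Real

/-- Chain rule along a ray `x ↦ (r x * a, r x * b)` with variable radius `r`. -/
theorem HasDerivAt.comp_ray {F : ℝ × ℝ → ℝ} {r : ℝ → ℝ} {r' x a b : ℝ}
    (hF : DifferentiableAt ℝ F (r x * a, r x * b)) (hr : HasDerivAt r r' x) :
    HasDerivAt (fun y => F (r y * a, r y * b))
      (r' * (a * fderiv ℝ F (r x * a, r x * b) (1, 0)
        + b * fderiv ℝ F (r x * a, r x * b) (0, 1))) x := by
  have h := hF.hasFDerivAt.comp_hasDerivAt x ((hr.mul_const a).prodMk (hr.mul_const b))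
  have hv : ((r' * a, r' * b) : ℝ × ℝ)
      = (r' * a) • ((1, 0) : ℝ × ℝ) + (r' * b) • ((0, 1) : ℝ × ℝ) := by
    ext <;> simp
  rw [hv, map_add, map_smul, map_smul, smul_eq_mul, smul_eq_mul] at h
  refine h.congr_deriv ?_
  ring

/-- The mixed second partial derivatives of a `C²` function commute. -/
theorem fderiv_partial_comm {F : ℝ × ℝ → ℝ} (hF : ContDiff ℝ 2 F) (p v w : ℝ × ℝ) :
    fderiv ℝ (fun q => fderiv ℝ F q v) p w = fderiv ℝ (fun q => fderiv ℝ F q w) p v := by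
  have hd : DifferentiableAt ℝ (fderiv ℝ F) p :=
    (hF.fderiv_right (m := 1) (by norm_num)).differentiable (by norm_num) p
  have hs : IsSymmSndFDerivAt ℝ F p := hF.contDiffAt.isSymmSndFDerivAt (by simp)
  have key (e : ℝ × ℝ) : fderiv ℝ (fun q => fderiv ℝ F q e) p
      = (fderiv ℝ (fderiv ℝ F) p).flip e := by
    rw [fderiv_clm_apply hd (differentiableAt_const e)]
    simp
  rw [key, key]
  exact hs w v

theorem neg_two_mul_log_pos {u : ℝ} (hu : u ∈ Set.Ioo (0 : ℝ) 1) : 0 < -2 * Real.log u := by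
  linarith [Real.log_neg hu.1 hu.2]

/-- Derivative of the Box-Muller radius. -/
theorem hasDerivAt_sqrt_neg_two_mul_log {u : ℝ} (hu : u ∈ Set.Ioo (0 : ℝ) 1) :
    HasDerivAt (fun x => Real.sqrt (-2 * Real.log x))
      (-(u * Real.sqrt (-2 * Real.log u))⁻¹) u := by
  have hpos := neg_two_mul_log_pos hu
  have h := ((Real.hasDerivAt_log hu.1.ne').const_mul (-2)).sqrt hpos.ne'
  refine h.congr_deriv ?_
  have h0 := hu.1.ne'
  have hr := (Real.sqrt_pos.2 hpos).ne'
  field_simp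

/-- Second derivative of the Box-Muller radius. -/
theorem hasDerivAt_neg_inv_mul_sqrt_neg_two_mul_log {u : ℝ} (hu : u ∈ Set.Ioo (0 : ℝ) 1) :
    HasDerivAt (fun x => -(x * Real.sqrt (-2 * Real.log x))⁻¹)
      (1 / (u ^ 2 * Real.sqrt (-2 * Real.log u)) * (1 - 1 / (-2 * Real.log u))) u := by
  have hpos := neg_two_mul_log_pos hu
  have hr := Real.sqrt_pos.2 hpos
  have h := (((hasDerivAt_id u).mul (hasDerivAt_sqrt_neg_two_mul_log hu)).inv
    (mul_pos hu.1 hr).ne').neg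
  refine h.congr_deriv ?_
  have h0 := hu.1.ne'
  have hsq := Real.sq_sqrt hpos.le
  simp only [id, Pi.mul_apply]
  generalize Real.sqrt (-2 * Real.log u) = r at *
  rw [← hsq]
  field_simp
  ring

theorem abs_mul_add_mul_le {s c x y : ℝ} (hs : |s| ≤ 1) (hc : |c| ≤ 1) :
    |s * x + c * y| ≤ |x| + |y| := by
  refine (abs_add_le _ _).trans ?_
  rw [abs_mul, abs_mul]
  exact add_le_add (mul_le_of_le_one_left (abs_nonneg _) hs)
    (mul_le_of_le_one_left (abs_nonneg _) hc)

theorem abs_quadratic_form_le {s c x y z : ℝ} (h : s ^ 2 + c ^ 2 = 1) :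
    |s * (s * x + c * y) + c * (s * y + c * z)| ≤ |x| + |y| + |z| := by
  have hs : |s ^ 2| ≤ 1 := by rw [abs_of_nonneg (sq_nonneg s)]; nlinarith [sq_nonneg c]
  have hc : |c ^ 2| ≤ 1 := by rw [abs_of_nonneg (sq_nonneg c)]; nlinarith [sq_nonneg s]
  have hm : |2 * s * c| ≤ 1 := by
    rw [abs_le]; constructor <;> nlinarith [sq_nonneg (s + c), sq_nonneg (s - c)]
  have e : s * (s * x + c * y) + c * (s * y + c * z)
      = s ^ 2 * x + 2 * s * c * y + c ^ 2 * z := by ring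
  rw [e]
  refine (abs_add_le _ _).trans (add_le_add (abs_mul_add_mul_le hs hm) ?_)
  rw [abs_mul]
  exact mul_le_of_le_one_left (abs_nonneg _) hc

/-- Bound on the second `u`-derivative of the Box-Muller pullback
`θ̃(u,v) = θ(√(-2 ln u) sin(2πv), √(-2 ln u) cos(2πv))`, for `θ` twice continuously
differentiable with `|∂θ/∂z₁| + |∂θ/∂z₂| ≤ D₁` and
`|∂²θ/∂z₁²| + |∂²θ/∂z₁∂z₂| + |∂²θ/∂z₂²| ≤ D₂`. -/
theorem box_muller_pullback_second_u_derivative_bound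
    (θ : ℝ × ℝ → ℝ) (hθ : ContDiff ℝ 2 θ) (D₁ D₂ : ℝ)
    (hD₁ : ∀ p : ℝ × ℝ, |fderiv ℝ θ p (1, 0)| + |fderiv ℝ θ p (0, 1)| ≤ D₁)
    (hD₂ : ∀ p : ℝ × ℝ,
      |fderiv ℝ (fun q => fderiv ℝ θ q (1, 0)) p (1, 0)|
        + |fderiv ℝ (fun q => fderiv ℝ θ q (1, 0)) p (0, 1)|
        + |fderiv ℝ (fun q => fderiv ℝ θ q (0, 1)) p (0, 1)| ≤ D₂)
    (u v : ℝ) (hu : u ∈ Set.Ioo (0 : ℝ) 1) :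
    |deriv (fun u' => deriv (fun u'' =>
        θ (Real.sqrt (-2 * Real.log u'') * Real.sin (2 * π * v),
           Real.sqrt (-2 * Real.log u'') * Real.cos (2 * π * v))) u') u|
      ≤ 1 / (u ^ 2 * Real.sqrt (-2 * Real.log u)) * (1 / (-2 * Real.log u) + 1) * D₁
        + 1 / (u ^ 2 * (-2 * Real.log u)) * D₂ := by
  have hpos := neg_two_mul_log_pos hu
  have hr := Real.sqrt_pos.2 hpos
  have hsc := Real.sin_sq_add_cos_sq (2 * π * v)
  have hs := Real.abs_sin_le_one (2 * π * v)
  have hc := Real.abs_cos_le_one (2 * π * v)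
  generalize Real.sin (2 * π * v) = s at *
  generalize Real.cos (2 * π * v) = c at *
  have hpartial (e : ℝ × ℝ) : Differentiable ℝ (fun q => fderiv ℝ θ q e) :=
    ((hθ.fderiv_right (m := 1) (by norm_num)).clm_apply contDiff_const).differentiable
      (by norm_num)
  have hfirst : (fun u' => deriv (fun u'' => θ (Real.sqrt (-2 * Real.log u'') * s,
        Real.sqrt (-2 * Real.log u'') * c)) u') =ᶠ[nhds u]
      fun x => -(x * Real.sqrt (-2 * Real.log x))⁻¹ *
        (s * fderiv ℝ θ (Real.sqrt (-2 * Real.log x) * s, Real.sqrt (-2 * Real.log x) * c) (1, 0)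
        + c * fderiv ℝ θ (Real.sqrt (-2 * Real.log x) * s,
          Real.sqrt (-2 * Real.log x) * c) (0, 1)) := by
    filter_upwards [isOpen_Ioo.mem_nhds hu] with x hx
    exact (HasDerivAt.comp_ray (hθ.differentiable (by norm_num) _)
      (hasDerivAt_sqrt_neg_two_mul_log hx)).deriv
  have hradius := hasDerivAt_sqrt_neg_two_mul_log hu
  have hsecond := (hasDerivAt_neg_inv_mul_sqrt_neg_two_mul_log hu).mul
    (((HasDerivAt.comp_ray (a := s) (b := c) (hpartial (1, 0) _) hradius).const_mul s).add
      ((HasDerivAt.comp_ray (a := s) (b := c) (hpartial (0, 1) _) hradius).const_mul c))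
  rw [hfirst.deriv_eq]
  refine (congrArg abs hsecond.deriv).trans_le ?_
  simp only [Pi.add_apply]
  have hsq := Real.sq_sqrt hpos.le
  have hu0 := hu.1
  generalize Real.sqrt (-2 * Real.log u) = r at *
  rw [fderiv_partial_comm hθ _ (0, 1) (1, 0)]
  have b₁ := (abs_mul_add_mul_le hs hc).trans (hD₁ (r * s, r * c))
  have b₂ := (abs_quadratic_form_le hsc).trans (hD₂ (r * s, r * c))
  rw [← hsq]
  generalize fderiv ℝ θ (r * s, r * c) (1, 0) = x₁ at *
  generalize fderiv ℝ θ (r * s, r * c) (0, 1) = x₂ at *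
  generalize fderiv ℝ (fun q => fderiv ℝ θ q (1, 0)) (r * s, r * c) (1, 0) = y₁ at *
  generalize fderiv ℝ (fun q => fderiv ℝ θ q (1, 0)) (r * s, r * c) (0, 1) = y₂ at *
  generalize fderiv ℝ (fun q => fderiv ℝ θ q (0, 1)) (r * s, r * c) (0, 1) = y₃ at *
  have hcoef : |1 / (u ^ 2 * r) * (1 - 1 / r ^ 2)| ≤ 1 / (u ^ 2 * r) * (1 / r ^ 2 + 1) := by
    have hinv : 0 < 1 / r ^ 2 := by positivity
    rw [abs_mul, abs_of_pos (by positivity : 0 < 1 / (u ^ 2 * r))]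
    gcongr
    rw [abs_le]
    constructor <;> linarith
  have hsplit : -(u * r)⁻¹ * (s * (-(u * r)⁻¹ * (s * y₁ + c * y₂))
        + c * (-(u * r)⁻¹ * (s * y₂ + c * y₃)))
      = 1 / (u ^ 2 * r ^ 2) * (s * (s * y₁ + c * y₂) + c * (s * y₂ + c * y₃)) := by
    field_simp
    ring
  rw [hsplit]
  refine (abs_add_le _ _).trans (add_le_add ?_ ?_)
  · rw [abs_mul]
    exact mul_le_mul hcoef b₁ (abs_nonneg _) (by positivity)
  · rw [abs_mul, abs_of_pos (by positivity : 0 < 1 / (u ^ 2 * r ^ 2))]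
    gcongr
end

section
/- Let θ : ℝ² → ℝ be twice continuously differentiable and suppose |∂θ/∂z₁| + |∂θ/∂z₂| ≤ D₁ and |∂²θ/∂z₁²| + |∂²θ/∂z₁∂z₂| + |∂²θ/∂z₂²| ≤ D₂ everywhere. Define θ̃(u,v) = θ( √(−2 ln u) sin(2πv), √(−2 ln u) cos(2πv) ) for u ∈ (0,1). Then for all u ∈ (0,1) and v ∈ ℝ, | ∂²θ̃/∂v² | ≤ (2π)²·√(−2 ln u)·D₁ + (2π)²·(−2 ln u)·D₂. -/
open Real

/-- The derivative along a curve in the plane, in terms of the two partial derivatives. -/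
theorem hasDerivAt_comp_prodMk {f : ℝ × ℝ → ℝ} {x y : ℝ → ℝ} {x' y' t : ℝ}
    (hf : DifferentiableAt ℝ f (x t, y t)) (hx : HasDerivAt x x' t) (hy : HasDerivAt y y' t) :
    HasDerivAt (fun s => f (x s, y s))
      (x' * fderiv ℝ f (x t, y t) (1, 0) + y' * fderiv ℝ f (x t, y t) (0, 1)) t := by
  have h := hf.hasFDerivAt.comp_hasDerivAt t (hx.prodMk hy)
  have e : ((x', y') : ℝ × ℝ) = x' • ((1, 0) : ℝ × ℝ) + y' • ((0, 1) : ℝ × ℝ) := by simp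
  rw [e, map_add, map_smul, map_smul, smul_eq_mul, smul_eq_mul] at h
  exact h

theorem ContDiff.differentiable_fderiv_apply_const {f : ℝ × ℝ → ℝ} (hf : ContDiff ℝ 2 f)
    (w : ℝ × ℝ) : Differentiable ℝ (fun q => fderiv ℝ f q w) :=
  ((hf.fderiv_right (m := 1) (by norm_num)).differentiable (by norm_num)).clm_apply
    (differentiable_const w)

/-- Symmetry of mixed directional derivatives. -/
theorem ContDiff.fderiv_fderiv_apply_comm {f : ℝ × ℝ → ℝ} (hf : ContDiff ℝ 2 f)
    (p w₁ w₂ : ℝ × ℝ) :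
    fderiv ℝ (fun q => fderiv ℝ f q w₁) p w₂ = fderiv ℝ (fun q => fderiv ℝ f q w₂) p w₁ := by
  have hd : DifferentiableAt ℝ (fderiv ℝ f) p :=
    (hf.fderiv_right (m := 1) (by norm_num)).differentiable (by norm_num) p
  have key : ∀ a b : ℝ × ℝ,
      fderiv ℝ (fun q => fderiv ℝ f q a) p b = fderiv ℝ (fderiv ℝ f) p b a := by
    intro a b
    rw [fderiv_clm_apply hd (differentiableAt_const a)]
    simp
  rw [key, key]
  exact (hf.contDiffAt.isSymmSndFDerivAt (by simp)) w₂ w₁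

/-- Size of the second angular derivative, given bounds on first and second partials. -/
theorem abs_second_angular_derivative_le {k r s c a b A B C D₁ D₂ : ℝ} (hr : 0 ≤ r)
    (hsc : s ^ 2 + c ^ 2 = 1) (h₁ : |a| + |b| ≤ D₁) (h₂ : |A| + |B| + |C| ≤ D₂) :
    |k ^ 2 * (r ^ 2 * (c ^ 2 * A - 2 * s * c * B + s ^ 2 * C) - r * (s * a + c * b))|
      ≤ k ^ 2 * r * D₁ + k ^ 2 * r ^ 2 * D₂ := by
  have mul_le : ∀ {x y : ℝ}, |x| ≤ 1 → |x * y| ≤ |y| := fun {x y} hx => by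
    rw [abs_mul]
    exact mul_le_of_le_one_left (abs_nonneg y) hx
  have hs : |s| ≤ 1 := abs_le.2 ⟨by nlinarith [sq_nonneg c], by nlinarith [sq_nonneg c]⟩
  have hc : |c| ≤ 1 := abs_le.2 ⟨by nlinarith [sq_nonneg s], by nlinarith [sq_nonneg s]⟩
  have hs2 : |s ^ 2| ≤ 1 := by rw [abs_of_nonneg (sq_nonneg s)]; nlinarith [sq_nonneg c]
  have hc2 : |c ^ 2| ≤ 1 := by rw [abs_of_nonneg (sq_nonneg c)]; nlinarith [sq_nonneg s]
  have hsc2 : |2 * s * c| ≤ 1 :=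
    abs_le.2 ⟨by nlinarith [sq_nonneg (s + c)], by nlinarith [sq_nonneg (s - c)]⟩
  have hF : |s * a + c * b| ≤ D₁ :=
    (abs_add_le _ _).trans ((add_le_add (mul_le hs) (mul_le hc)).trans h₁)
  have hS : |c ^ 2 * A - 2 * s * c * B + s ^ 2 * C| ≤ D₂ :=
    (abs_add_le _ _).trans ((add_le_add ((abs_sub _ _).trans
      (add_le_add (mul_le hc2) (mul_le hsc2))) (mul_le hs2)).trans h₂)
  have hmain : |r ^ 2 * (c ^ 2 * A - 2 * s * c * B + s ^ 2 * C) - r * (s * a + c * b)|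
      ≤ r ^ 2 * D₂ + r * D₁ := by
    refine (abs_sub _ _).trans (add_le_add ?_ ?_)
    · rw [abs_mul, abs_of_nonneg (sq_nonneg r)]
      gcongr
    · rw [abs_mul, abs_of_nonneg hr]
      gcongr
  rw [abs_mul, abs_of_nonneg (sq_nonneg k)]
  exact (mul_le_mul_of_nonneg_left hmain (sq_nonneg k)).trans_eq (by ring)

/-- Bound on the second `v`-derivative of the Box-Muller pullback
`θ̃(u,v) = θ(√(-2 ln u) sin(2πv), √(-2 ln u) cos(2πv))`, for `θ` twice continuously
differentiable with `|∂θ/∂z₁| + |∂θ/∂z₂| ≤ D₁` and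
`|∂²θ/∂z₁²| + |∂²θ/∂z₁∂z₂| + |∂²θ/∂z₂²| ≤ D₂`. -/
theorem box_muller_pullback_second_v_derivative_bound
    (θ : ℝ × ℝ → ℝ) (hθ : ContDiff ℝ 2 θ) (D₁ D₂ : ℝ)
    (hD₁ : ∀ p : ℝ × ℝ, |fderiv ℝ θ p (1, 0)| + |fderiv ℝ θ p (0, 1)| ≤ D₁)
    (hD₂ : ∀ p : ℝ × ℝ,
      |fderiv ℝ (fun q => fderiv ℝ θ q (1, 0)) p (1, 0)|
        + |fderiv ℝ (fun q => fderiv ℝ θ q (1, 0)) p (0, 1)|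
        + |fderiv ℝ (fun q => fderiv ℝ θ q (0, 1)) p (0, 1)| ≤ D₂)
    (u v : ℝ) (hu : u ∈ Set.Ioo (0 : ℝ) 1) :
    |deriv (fun v' => deriv (fun v'' =>
        θ (Real.sqrt (-2 * Real.log u) * Real.sin (2 * π * v''),
           Real.sqrt (-2 * Real.log u) * Real.cos (2 * π * v''))) v') v|
      ≤ (2 * π) ^ 2 * Real.sqrt (-2 * Real.log u) * D₁
        + (2 * π) ^ 2 * (-2 * Real.log u) * D₂ := by
  obtain ⟨hu0, hu1⟩ := hu
  have hlog : 0 ≤ -2 * Real.log u := by linarith [Real.log_neg hu0 hu1]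
  set r := Real.sqrt (-2 * Real.log u) with hrdef
  have hr : 0 ≤ r := Real.sqrt_nonneg _
  rw [← Real.sq_sqrt hlog, ← hrdef]
  have hlin : ∀ t : ℝ, HasDerivAt (fun t : ℝ => 2 * π * t) (2 * π) t := fun t => by
    simpa using (hasDerivAt_id t).const_mul (2 * π)
  have hx : ∀ t : ℝ, HasDerivAt (fun t => r * Real.sin (2 * π * t))
      (r * (Real.cos (2 * π * t) * (2 * π))) t := fun t => (hlin t).sin.const_mul r
  have hy : ∀ t : ℝ, HasDerivAt (fun t => r * Real.cos (2 * π * t))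
      (r * (-Real.sin (2 * π * t) * (2 * π))) t := fun t => (hlin t).cos.const_mul r
  have hx' := (((hlin v).cos.mul_const (2 * π)).const_mul r)
  have hy' := (((hlin v).sin.neg.mul_const (2 * π)).const_mul r)
  have hθd : Differentiable ℝ θ := hθ.differentiable (by norm_num)
  have hfirst := funext fun t => (hasDerivAt_comp_prodMk (hθd _) (hx t) (hy t)).deriv
  have hg : ∀ w : ℝ × ℝ, _ := fun w =>
    hasDerivAt_comp_prodMk (hθ.differentiable_fderiv_apply_const w _) (hx v) (hy v)
  have hsecond := ((hx'.mul (hg (1, 0))).add (hy'.mul (hg (0, 1)))).deriv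
  rw [hfirst]
  refine (congrArg abs (hsecond.trans ?_)).trans_le
    (abs_second_angular_derivative_le (k := 2 * π) hr (Real.sin_sq_add_cos_sq (2 * π * v))
      (hD₁ (r * Real.sin (2 * π * v), r * Real.cos (2 * π * v)))
      (hD₂ (r * Real.sin (2 * π * v), r * Real.cos (2 * π * v))))
  rw [hθ.fderiv_fderiv_apply_comm _ (0, 1) (1, 0)]
  simp only [Pi.neg_apply]
  ring
end
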